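/- arXiv:1310.2899 — 5 statements merged into one kernel-verified Lean document; each statement's English description precedes it below -/
import Mathlib

section
/- Let q ∈ ℝ, q ≠ 0, and let γ : ℝ → ℍ be a smooth curve with ‖γ(s)‖ = 1 and ‖γ′(s)‖ = 1 for all s, satisfying γ″(s) + γ(s) = q·(γ′(s)·𝐤 + ⟨γ′(s), γ(s)·𝐤⟩·γ(s)) for all s. Then the function s ↦ ⟨γ′(s), γ(s)·𝐤⟩ is constant; i.e. a normal magnetic curve on 𝕊³ makes a constant contact angle θ with the Reeb vector field. -/
open Quaternion
open scoped RealInnerProductSpace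

/-- The quaternion `𝐤`. -/
noncomputable def qk : ℍ[ℝ] := ⟨0, 0, 0, 1⟩

lemma aux_re : qk.re = 0 := rfl
lemma aux_i : qk.imI = 0 := rfl
lemma aux_j : qk.imJ = 0 := rfl
lemma aux_k : qk.imK = 1 := rfl

lemma aux_skew (x : ℍ[ℝ]) : ⟪x, x * qk⟫ = 0 := by
  simp [Quaternion.inner_def, Quaternion.re_mul, Quaternion.imI_mul, Quaternion.imJ_mul, Quaternion.imK_mul, aux_re, aux_i, aux_j, aux_k]
  ring

lemma aux_isom (x y : ℍ[ℝ]) : ⟪x * qk, y * qk⟫ = ⟪x, y⟫ := by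
  simp [Quaternion.inner_def, Quaternion.re_mul, Quaternion.imI_mul, Quaternion.imJ_mul, Quaternion.imK_mul, aux_re, aux_i, aux_j, aux_k]
  ring

/-- A normal magnetic curve of strength `q ≠ 0` on `𝕊³` (unit quaternions),
i.e. a smooth unit-speed curve on the unit sphere satisfying the ambient Lorentz equation
`γ″ + γ = q (γ′·𝐤 + ⟨γ′, γ·𝐤⟩ γ)`, makes a constant contact angle with the Reeb field:
`s ↦ ⟨γ′(s), γ(s)·𝐤⟩` is constant. -/
theorem contact_angle_is_constant (q : ℝ) (hq : q ≠ 0) (γ : ℝ → ℍ[ℝ])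
    (hsmooth : ContDiff ℝ (⊤ : ℕ∞) γ)
    (hsphere : ∀ s : ℝ, ‖γ s‖ = 1)
    (hspeed : ∀ s : ℝ, ‖deriv γ s‖ = 1)
    (hlorentz : ∀ s : ℝ, deriv (deriv γ) s + γ s =
      q • (deriv γ s * qk + ⟪deriv γ s, γ s * qk⟫ • γ s)) :
    ∀ s t : ℝ, ⟪deriv γ s, γ s * qk⟫ = ⟪deriv γ t, γ t * qk⟫ := by
  have hd : ∀ s, HasDerivAt γ (deriv γ s) s := fun s =>
    ((hsmooth.differentiable (by simp)) s).hasDerivAt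
  have hsm1 : ContDiff ℝ (⊤ : ℕ∞) (deriv γ) := by
    have := (contDiff_infty_iff_deriv (𝕜 := ℝ) (f := γ)).1 hsmooth
    exact this.2
  have hdd : ∀ s, HasDerivAt (deriv γ) (deriv (deriv γ) s) s := fun s =>
    ((hsm1.differentiable (by simp)) s).hasDerivAt
  have horth : ∀ s, ⟪deriv γ s, γ s⟫ = 0 := by
    intro s
    have h1 := (hd s).inner ℝ (hd s)
    have h2 : (fun t => ⟪γ t, γ t⟫) = fun _ => (1 : ℝ) := by
      funext t
      rw [real_inner_self_eq_norm_sq, hsphere t]; norm_num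
    rw [h2] at h1
    have h3 := h1.unique (hasDerivAt_const s (1 : ℝ))
    rw [real_inner_comm (deriv γ s) (γ s)] at h3
    linarith
  have key : ∀ s, HasDerivAt (fun t => ⟪deriv γ t, γ t * qk⟫) 0 s := by
    intro s
    have h1 := (hdd s).inner ℝ ((hd s).mul_const qk)
    have h2 : deriv (deriv γ) s =
      q • (deriv γ s * qk + ⟪deriv γ s, γ s * qk⟫ • γ s) - γ s :=
      eq_sub_of_add_eq (hlorentz s)
    have h3 : ⟪deriv γ s, deriv γ s * qk⟫ + ⟪deriv (deriv γ) s, γ s * qk⟫ = 0 := by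
     rw [h2, inner_sub_left, real_inner_smul_left, inner_add_left, real_inner_smul_left,
       aux_isom, aux_skew, aux_skew, horth]
     ring
    exact h3 ▸ h1
  intro s t
  exact is_const_of_deriv_eq_zero (fun x => (key x).differentiableAt)
    (fun x => (key x).deriv) s t
end

section
/- Let a ∈ ℍ with ‖a‖ = 1 and let X ∈ ℍ satisfy ⟨X, a⟩ = 0 and ⟨X, a·𝐤⟩ = 0 (i.e. X is a horizontal tangent vector to 𝕊³ at a). Then ‖½·(X·𝐤·conj(a) + a·𝐤·conj(X))‖ = ‖X‖. (Hence the Hopf projection π(a) = ½·a·𝐤·conj(a) from 𝕊³ onto the sphere of radius ½ is a Riemannian submersion: its differential preserves the length of horizontal vectors.) -/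
open Quaternion
open scoped RealInnerProductSpace

/-- The differential of the Hopf projection `π(a) = ½ a·𝐤·conj a`
preserves the length of horizontal tangent vectors: if `‖a‖ = 1`, `⟨X, a⟩ = 0` and
`⟨X, a·𝐤⟩ = 0`, then `‖½ (X·𝐤·conj a + a·𝐤·conj X)‖ = ‖X‖`. -/
theorem hopf_projection_is_riemannian_submersion (a X : ℍ[ℝ])
    (ha : ‖a‖ = 1) (htangent : ⟪X, a⟫ = 0) (hhorizontal : ⟪X, a * qk⟫ = 0) :
    ‖(1 / 2 : ℝ) • (X * qk * star a + a * qk * star X)‖ = ‖X‖ := by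
  have hk : ‖qk‖ = 1 := by
    have h : ‖qk‖ * ‖qk‖ = 1 := by
      rw [← Quaternion.normSq_eq_norm_mul_self, Quaternion.normSq_def']
      simp [qk]
    nlinarith [norm_nonneg qk]
  have k0 : qk.re = 0 := rfl
  have k1 : qk.imI = 0 := rfl
  have k2 : qk.imJ = 0 := rfl
  have k3 : qk.imK = 1 := rfl
  have key : (1 / 2 : ℝ) • (X * qk * star a + a * qk * star X) = X * qk * star a := by
    rw [Quaternion.inner_def] at hhorizontal
    simp [k0, k1, k2, k3] at hhorizontal
    ext <;> simp [k0, k1, k2, k3] <;> linarith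
  rw [key, norm_mul, norm_mul, Quaternion.norm_star, ha, hk, mul_one, mul_one]
end

section
/- Let β̂ : ℝ → ℍ be a smooth curve with ‖β̂(u)‖ = 1, ‖β̂′(u)‖ = 1 and ⟨β̂′(u), β̂(u)·𝐤⟩ = 0 for all u (a unit-speed horizontal curve in 𝕊³). Define F : ℝ × ℝ → ℍ by F(t,u) = β̂(u)·(cos t + (sin t)·𝐤). Then for all (t,u): ‖∂F/∂t (t,u)‖ = 1, ‖∂F/∂u (t,u)‖ = 1, and ⟨∂F/∂t (t,u), ∂F/∂u (t,u)⟩ = 0. (Hence the induced metric on the Hopf tube over β̂ is the flat metric dt² + du², so the Hopf tube over a curve of length L is isometric to the flat cylinder 𝕊¹ × [0, L].) -/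
open Quaternion
open scoped RealInnerProductSpace

/-- Let `β̂` be a unit-speed horizontal curve in `𝕊³` (unit quaternions)
and let `F(t,u) = β̂(u)·(cos t + sin t·𝐤)` be the parametrization of the Hopf tube over
(the projection of) `β̂`. Then `‖∂F/∂t‖ = 1`, `‖∂F/∂u‖ = 1` and `⟨∂F/∂t, ∂F/∂u⟩ = 0`,
so the induced metric on the Hopf tube is the flat metric `dt² + du²`. -/
theorem hopf_tube_is_flat (betahat : ℝ → ℍ[ℝ])
    (hsmooth : ContDiff ℝ (⊤ : ℕ∞) betahat)
    (hsphere : ∀ u : ℝ, ‖betahat u‖ = 1)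
    (hspeed : ∀ u : ℝ, ‖deriv betahat u‖ = 1)
    (hhorizontal : ∀ u : ℝ, ⟪deriv betahat u, betahat u * qk⟫ = 0)
    (F : ℝ → ℝ → ℍ[ℝ])
    (hF : ∀ t u : ℝ, F t u = betahat u * ((Real.cos t : ℍ[ℝ]) + Real.sin t • qk)) :
    ∀ t u : ℝ,
      ‖deriv (fun t' => F t' u) t‖ = 1 ∧
      ‖deriv (fun u' => F t u') u‖ = 1 ∧
      ⟪deriv (fun t' => F t' u) t, deriv (fun u' => F t u') u⟫ = 0 := by
  intro t u
  have q0 : qk.re = 0 := rfl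
  have q1 : qk.imI = 0 := rfl
  have q2 : qk.imJ = 0 := rfl
  have q3 : qk.imK = 1 := rfl
  have hcoe : ∀ r : ℝ, (r : ℍ[ℝ]) = r • (1 : ℍ[ℝ]) := fun r => by
    ext <;> simp
  have hn : ∀ a b : ℝ, a ^ 2 + b ^ 2 = 1 → ‖a • (1 : ℍ[ℝ]) + b • qk‖ = 1 := by
    intro a b h
    have h1 : ‖a • (1 : ℍ[ℝ]) + b • qk‖ * ‖a • (1 : ℍ[ℝ]) + b • qk‖ = 1 := by
      rw [← Quaternion.normSq_eq_norm_mul_self, Quaternion.normSq_def']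
      simp [q0, q1, q2, q3, h]
    nlinarith [norm_nonneg (a • (1 : ℍ[ℝ]) + b • qk)]
  have hdt : HasDerivAt (fun t' => F t' u)
      (betahat u * ((-Real.sin t) • (1 : ℍ[ℝ]) + Real.cos t • qk)) t := by
    have h : (fun t' => F t' u) =
        fun t' => betahat u * (Real.cos t' • (1 : ℍ[ℝ]) + Real.sin t' • qk) := by
      funext t'
      rw [hF, hcoe]
    rw [h]
    exact (((Real.hasDerivAt_cos t).smul_const (1 : ℍ[ℝ])).add
      ((Real.hasDerivAt_sin t).smul_const qk)).const_mul (betahat u)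
  have hdu : HasDerivAt (fun u' => F t u')
      (deriv betahat u * (Real.cos t • (1 : ℍ[ℝ]) + Real.sin t • qk)) u := by
    have h : (fun u' => F t u') =
        fun u' => betahat u' * (Real.cos t • (1 : ℍ[ℝ]) + Real.sin t • qk) := by
      funext u'
      rw [hF, hcoe]
    rw [h]
    have hb : HasDerivAt betahat (deriv betahat u) u :=
      ((hsmooth.differentiable (by simp)) u).hasDerivAt
    exact hb.mul_const _
  rw [hdt.deriv, hdu.deriv]
  refine ⟨?_, ?_, ?_⟩
  · rw [norm_mul, hsphere, hn _ _ (by simp), one_mul]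
  · rw [norm_mul, hspeed, hn _ _ (by simp), one_mul]
  · have h := hhorizontal u
    have hcs := Real.sin_sq_add_cos_sq t
    rw [Quaternion.inner_def] at h ⊢
    generalize deriv betahat u = d at *
    generalize betahat u = b at *
    simp [q0, q1, q2, q3] at h ⊢
    linear_combination (Real.sin t ^ 2 + Real.cos t ^ 2) * h
end

section
/- Let ψ, a, b ∈ ℝ with a²·cos²ψ + b²·sin²ψ = 1, a > 0, cos ψ ≠ 0 and sin ψ ≠ 0, and define γ : ℝ → ℝ⁴ by γ(s) = (cos ψ·cos(a s), cos ψ·sin(a s), sin ψ·cos(b s), sin ψ·sin(b s)). Then γ is periodic (i.e. there exists L > 0 with γ(s + L) = γ(s) for all s) if and only if there exists a rational number p with a = 1/√(p²·sin²ψ + cos²ψ) and b = p·a (equivalently, if and only if b/a ∈ ℚ). -/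
/-- The model helix
`γ(s) = (cos ψ cos(as), cos ψ sin(as), sin ψ cos(bs), sin ψ sin(bs))` on `𝕊³`
(with `a² cos²ψ + b² sin²ψ = 1`, `a > 0`, `cos ψ ≠ 0`, `sin ψ ≠ 0`) is periodic
if and only if there is a rational number `p` with
`a = 1/√(p² sin²ψ + cos²ψ)` and `b = p·a`. -/
theorem model_helix_periodicity (ψ a b : ℝ)
    (hconstraint : a ^ 2 * Real.cos ψ ^ 2 + b ^ 2 * Real.sin ψ ^ 2 = 1)
    (ha : 0 < a) (hcos : Real.cos ψ ≠ 0) (hsin : Real.sin ψ ≠ 0)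
    (γ : ℝ → EuclideanSpace ℝ (Fin 4))
    (hγ : ∀ s : ℝ, γ s = (WithLp.equiv 2 (Fin 4 → ℝ)).symm
      ![Real.cos ψ * Real.cos (a * s), Real.cos ψ * Real.sin (a * s),
        Real.sin ψ * Real.cos (b * s), Real.sin ψ * Real.sin (b * s)]) :
    (∃ L : ℝ, 0 < L ∧ ∀ s : ℝ, γ (s + L) = γ s) ↔
    (∃ p : ℚ, a = 1 / Real.sqrt ((p : ℝ) ^ 2 * Real.sin ψ ^ 2 + Real.cos ψ ^ 2) ∧
      b = (p : ℝ) * a) := by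
  constructor
  · rintro ⟨L, hL, h⟩
    have h0 := h 0
    rw [hγ, hγ] at h0
    have e0 := congrArg (fun v : EuclideanSpace ℝ (Fin 4) => v 0) h0
    have e2 := congrArg (fun v : EuclideanSpace ℝ (Fin 4) => v 2) h0
    simp [hcos] at e0
    simp [hsin] at e2
    obtain ⟨n, hn⟩ := (Real.cos_eq_one_iff _).1 e0
    obtain ⟨m, hm⟩ := (Real.cos_eq_one_iff _).1 e2
    have hn0 : (n : ℝ) ≠ 0 := by
      intro h
      rw [h] at hn
      have := mul_pos ha hL
      linarith
    have hb : b = ((m / n : ℚ) : ℝ) * a := by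
      push_cast
      rw [div_mul_eq_mul_div, eq_div_iff hn0]
      apply mul_right_cancel₀ hL.ne'
      linear_combination (-(n : ℝ)) * hm + (m : ℝ) * hn
    refine ⟨m / n, ?_, hb⟩
    generalize ((m / n : ℚ) : ℝ) = p at *
    have hX : p ^ 2 * Real.sin ψ ^ 2 + Real.cos ψ ^ 2 = (1 / a) ^ 2 := by
      rw [div_pow, eq_div_iff (by positivity)]
      rw [hb] at hconstraint
      linear_combination hconstraint
    rw [hX, Real.sqrt_sq (by positivity)]
    simp
  · rintro ⟨p, -, hb⟩
    have hq : (0 : ℝ) < p.den := by exact_mod_cast p.den_pos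
    have hp : (p : ℝ) * p.den = p.num := by exact_mod_cast Rat.mul_den_eq_num p
    have ha' := ha.ne'
    refine ⟨p.den * (2 * Real.pi) / a, by positivity, fun s => ?_⟩
    have h1 : a * (s + p.den * (2 * Real.pi) / a) = a * s + p.den * (2 * Real.pi) := by
      field_simp
    have h2 : b * (s + p.den * (2 * Real.pi) / a) = b * s + p.num * (2 * Real.pi) := by
      rw [← hp, hb]
      field_simp
    rw [hγ, hγ, h1, h2, Real.cos_add_nat_mul_two_pi, Real.sin_add_nat_mul_two_pi,
      Real.cos_add_int_mul_two_pi, Real.sin_add_int_mul_two_pi]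
end

section
/- Let θ ∈ ℝ with sin θ ≠ 0, set ω = √(5/4 − cos θ), and let γ : ℝ → ℝ⁴ be the curve γ(s) = (x₁(s), x₂(s), x₃(s), x₄(s)) with x₁(s) = cos(s/2)·cos(ω s) − (1/ω)·(cos θ − ½)·sin(s/2)·sin(ω s), x₂(s) = sin(s/2)·cos(ω s) + (1/ω)·(cos θ − ½)·cos(s/2)·sin(ω s), x₃(s) = (sin θ/ω)·cos(s/2)·sin(ω s), x₄(s) = (sin θ/ω)·sin(s/2)·sin(ω s). Then γ is periodic (i.e. there exists L > 0 with γ(s + L) = γ(s) for all s) if and only if ω is a rational number. -/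
/-- Ikawa's explicit normal magnetic curve of strength `1` and contact
angle `θ` (with `sin θ ≠ 0`) on `𝕊³`, where `ω = √(5/4 − cos θ)`, is periodic if and
only if `ω` is a rational number. -/
theorem ikawa_curve_periodic_iff_omega_rational (θ ω : ℝ)
    (hθ : Real.sin θ ≠ 0)
    (hω : ω = Real.sqrt (5 / 4 - Real.cos θ))
    (x₁ x₂ x₃ x₄ : ℝ → ℝ)
    (h₁ : ∀ s : ℝ, x₁ s = Real.cos (s / 2) * Real.cos (ω * s) -
      (1 / ω) * (Real.cos θ - 1 / 2) * Real.sin (s / 2) * Real.sin (ω * s))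
    (h₂ : ∀ s : ℝ, x₂ s = Real.sin (s / 2) * Real.cos (ω * s) +
      (1 / ω) * (Real.cos θ - 1 / 2) * Real.cos (s / 2) * Real.sin (ω * s))
    (h₃ : ∀ s : ℝ, x₃ s = (Real.sin θ / ω) * Real.cos (s / 2) * Real.sin (ω * s))
    (h₄ : ∀ s : ℝ, x₄ s = (Real.sin θ / ω) * Real.sin (s / 2) * Real.sin (ω * s))
    (γ : ℝ → EuclideanSpace ℝ (Fin 4))
    (hγ : ∀ s : ℝ, γ s = (WithLp.equiv 2 (Fin 4 → ℝ)).symm ![x₁ s, x₂ s, x₃ s, x₄ s]) :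
    (∃ L : ℝ, 0 < L ∧ ∀ s : ℝ, γ (s + L) = γ s) ↔ (∃ r : ℚ, ω = (r : ℝ)) := by
  have hpos : 0 < ω := by
    rw [hω]
    apply Real.sqrt_pos.mpr
    linarith [Real.cos_le_one θ]
  constructor
  · rintro ⟨L, hL, hper⟩
    have h0 := hper 0
    rw [zero_add, hγ, hγ] at h0
    have hv := (WithLp.equiv 2 (Fin 4 → ℝ)).symm.injective h0
    have e2 : x₂ L = x₂ 0 := by simpa using congrFun hv 1
    have e3 : x₃ L = x₃ 0 := by simpa using congrFun hv 2
    have e4 : x₄ L = x₄ 0 := by simpa using congrFun hv 3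
    rw [h₂, h₂] at e2
    rw [h₃, h₃] at e3
    rw [h₄, h₄] at e4
    simp only [mul_zero, Real.sin_zero, zero_div, zero_mul, add_zero] at e2 e3 e4
    have hc : Real.sin θ / ω ≠ 0 := div_ne_zero hθ hpos.ne'
    have hs : Real.sin (ω * L) = 0 := by
      by_contra hne
      have a3 : Real.cos (L / 2) = 0 := by
        simpa [hθ, hpos.ne', hne] using e3
      have a4 : Real.sin (L / 2) = 0 := by
        simpa [hθ, hpos.ne', hne] using e4
      have := Real.sin_sq_add_cos_sq (L / 2)
      rw [a3, a4] at this
      norm_num at this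
    have hcos : Real.cos (ω * L) ≠ 0 := by
      intro h
      have := Real.sin_sq_add_cos_sq (ω * L)
      rw [hs, h] at this
      norm_num at this
    rw [hs, mul_zero, add_zero] at e2
    have hs2 : Real.sin (L / 2) = 0 := (mul_eq_zero.mp e2).resolve_right hcos
    obtain ⟨n, hn⟩ := Real.sin_eq_zero_iff.mp hs
    obtain ⟨m, hm⟩ := Real.sin_eq_zero_iff.mp hs2
    have hLm : L = 2 * (m * Real.pi) := by linarith
    have hm0 : (m : ℝ) ≠ 0 := by
      intro h
      rw [h] at hLm
      simp at hLm
      exact hL.ne' hLm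
    refine ⟨(n : ℚ) / (2 * m), ?_⟩
    push_cast
    rw [eq_div_iff (by simpa using hm0)]
    apply mul_right_cancel₀ Real.pi_ne_zero
    rw [hn, hLm]
    ring
  · rintro ⟨r, hr⟩
    have hq : (0 : ℝ) < r.den := by exact_mod_cast r.den_pos
    refine ⟨4 * Real.pi * r.den, by positivity, fun s => ?_⟩
    have a1 : (s + 4 * Real.pi * r.den) / 2 = s / 2 + (r.den : ℕ) * (2 * Real.pi) := by ring
    have a2 : ω * (s + 4 * Real.pi * r.den) = ω * s + ((2 * r.num : ℤ) : ℝ) * (2 * Real.pi) := by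
      have hω' : ω * r.den = r.num := by
        rw [hr]
        exact_mod_cast Rat.mul_den_eq_num r
      push_cast
      linear_combination (4 * Real.pi) * hω'
    rw [hγ, hγ]
    simp only [h₁, h₂, h₃, h₄, a1, a2, Real.cos_add_nat_mul_two_pi, Real.sin_add_nat_mul_two_pi,
      Real.cos_add_int_mul_two_pi, Real.sin_add_int_mul_two_pi]
end
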